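/- arXiv:2505.22309 — 2 statements merged into one kernel-verified Lean document; each statement's English description precedes it below -/
import Mathlib

section
/- Let d ≥ 1 and let C ∈ M_d(ℂ) be self-adjoint with largest eigenvalue λ_max and smallest eigenvalue λ_min, and set R = (λ_max − λ_min)/2. Then d·Tr(C²) − (Tr C)² ≥ 2·d·R². -/
theorem aux_scalar (d : ℕ) (hd : 1 ≤ d) (a : Fin d → ℝ) (i j : Fin d) :
    2 * (d : ℝ) * ((a i - a j) / 2) ^ 2 ≤ (d : ℝ) * (∑ k, a k * a k) - (∑ k, a k) ^ 2 := by
  have hd0 : (0 : ℝ) < d := by exact_mod_cast hd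
  obtain ⟨m, hm⟩ : ∃ m : ℝ, ∑ k, a k = d * m := ⟨(∑ k, a k) / d, by field_simp⟩
  have h1 : ∑ k, (a k - m) ^ 2 = ∑ k, a k * a k - d * m ^ 2 := by
    have : ∀ k, (a k - m) ^ 2 = a k * a k - 2 * m * a k + m ^ 2 := fun k => by ring
    simp only [this, Finset.sum_add_distrib, Finset.sum_sub_distrib, ← Finset.mul_sum, hm]
    simp
    ring
  have h2 : (a i - a j) ^ 2 / 2 ≤ ∑ k, (a k - m) ^ 2 := by
    by_cases hij : i = j
    · subst hij
      simpa using Finset.sum_nonneg (fun k _ => sq_nonneg (a k - m))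
    · have : ∑ k ∈ {i, j}, (a k - m) ^ 2 ≤ ∑ k, (a k - m) ^ 2 :=
        Finset.sum_le_sum_of_subset_of_nonneg (Finset.subset_univ _)
          (fun k _ _ => sq_nonneg _)
      rw [Finset.sum_pair hij] at this
      nlinarith [sq_nonneg (a i - m + (a j - m))]
  rw [hm]
  nlinarith [mul_le_mul_of_nonneg_left h2 hd0.le]

theorem aux_trace (d : ℕ) (C : Matrix (Fin d) (Fin d) ℂ) (hC : C.IsHermitian) :
    Matrix.trace (C * C) = ∑ k, (hC.eigenvalues k : ℂ) * (hC.eigenvalues k : ℂ) := by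
  conv_lhs => rw [hC.spectral_theorem]
  rw [← map_mul, Unitary.conjStarAlgAut_apply, Matrix.trace_mul_cycle]
  simp [Matrix.diagonal_mul_diagonal, Matrix.trace_diagonal]


/-- For a self-adjoint `C ∈ M_d(ℂ)` with largest eigenvalue `λmax`, smallest eigenvalue
`λmin`, and `R = (λmax − λmin)/2`, one has `d·Tr(C²) − (Tr C)² ≥ 2·d·R²`
(all traces being real since `C` is Hermitian). -/
theorem stmt_13 (d : ℕ) (hd : 1 ≤ d) (C : Matrix (Fin d) (Fin d) ℂ) (hC : C.IsHermitian)
    (lmin lmax : ℝ)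
    (hmax : IsGreatest {x : ℝ | (x : ℂ) ∈ spectrum ℂ C} lmax)
    (hmin : IsLeast {x : ℝ | (x : ℂ) ∈ spectrum ℂ C} lmin) :
    2 * (d : ℝ) * ((lmax - lmin) / 2) ^ 2 ≤
      (d : ℝ) * (Matrix.trace (C * C)).re - ((Matrix.trace C).re) ^ 2 := by
  have key : ∀ x : ℝ, (x : ℂ) ∈ spectrum ℂ C → ∃ i, hC.eigenvalues i = x := by
    intro x hx
    rw [hC.spectrum_eq_image_range] at hx
    simpa using hx
  obtain ⟨i, hi⟩ := key _ hmax.1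
  obtain ⟨j, hj⟩ := key _ hmin.1
  have h := aux_scalar d hd hC.eigenvalues i j
  rw [hi, hj] at h
  rw [aux_trace d C hC, hC.trace_eq_sum_eigenvalues]
  simpa using h
end

section
/- Let d ≥ 2 and let C ∈ M_d(ℂ) be self-adjoint. For V ∈ U(d), let M_V ∈ M₂(ℂ) denote the top-left 2×2 block of V*·C·V (equivalently, the compression of C to the subspace V·span{e₁, e₂}, where e₁, e₂ are the first two standard basis vectors), and let R(M_V) = (λ_max(M_V) − λ_min(M_V))/2 denote half the gap between the two (real) eigenvalues of the self-adjoint 2×2 matrix M_V, so that R(M_V)² = ((Tr M_V)² − 4·det M_V)/4. Then for a Haar-random unitary V ∈ U(d): 𝔼_{V∼μ_d}[ R(M_V)² ] = (3 / (2·d·(d²−1))) · ( d·Tr(C²) − (Tr C)² ). -/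
open MeasureTheory

/-- Matrices carry the (Borel) product σ-algebra. -/
instance matrixMeasurableSpace {m n α : Type*} [MeasurableSpace α] :
    MeasurableSpace (Matrix m n α) :=
  inferInstanceAs (MeasurableSpace (m → n → α))

/-- A measure on a compact group (such as `U(d)`) is the Haar probability measure iff it
is a left-invariant probability measure. -/
def IsHaarProbability {G : Type*} [Group G] [MeasurableSpace G] (μ : Measure G) : Prop :=
  IsProbabilityMeasure μ ∧
    ∀ (g : G) (s : Set G), MeasurableSet s → μ ((fun x => g * x) ⁻¹' s) = μ s

/-- The top-left `2 × 2` block of `V* · C · V`, i.e. the compression of `C` to the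
subspace `V·span{e₁, e₂}` in the orthonormal basis `{V e₁, V e₂}`. -/
noncomputable def topLeftBlock2 {d : ℕ} (hd : 2 ≤ d) (C V : Matrix (Fin d) (Fin d) ℂ) :
    Matrix (Fin 2) (Fin 2) ℂ :=
  Matrix.of fun i j => (V.conjTranspose * C * V) (Fin.castLE hd i) (Fin.castLE hd j)


section Aux

variable {d : ℕ}

theorem aux_meas_entry (i j : Fin d) :
    Measurable (fun V : Matrix.unitaryGroup (Fin d) ℂ => (V : Matrix (Fin d) (Fin d) ℂ) i j) :=
  (measurable_pi_apply j).comp ((measurable_pi_apply i).comp measurable_subtype_coe)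

theorem aux_meas_mul (g : Matrix.unitaryGroup (Fin d) ℂ) :
    Measurable (fun V : Matrix.unitaryGroup (Fin d) ℂ => g * V) := by
  apply Measurable.subtype_mk
  apply measurable_pi_lambda
  intro i
  apply measurable_pi_lambda
  intro j
  have : Measurable (fun V : Matrix.unitaryGroup (Fin d) ℂ =>
      ∑ k, (g : Matrix (Fin d) (Fin d) ℂ) i k * (V : Matrix (Fin d) (Fin d) ℂ) k j) :=
    Finset.measurable_sum _ fun k _ => (aux_meas_entry k j).const_mul _
  exact this

theorem aux_inv (μ : Measure (Matrix.unitaryGroup (Fin d) ℂ)) (hμ : IsHaarProbability μ)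
    (g : Matrix.unitaryGroup (Fin d) ℂ) (f : Matrix.unitaryGroup (Fin d) ℂ → ℝ) :
    ∫ V, f (g * V) ∂μ = ∫ V, f V ∂μ := by
  let e : Matrix.unitaryGroup (Fin d) ℂ ≃ᵐ Matrix.unitaryGroup (Fin d) ℂ :=
    { toEquiv := Equiv.mulLeft g
      measurable_toFun := aux_meas_mul g
      measurable_invFun := aux_meas_mul g⁻¹ }
  have hmap : Measure.map e μ = μ := by
    ext s hs
    rw [Measure.map_apply e.measurable hs]
    exact hμ.2 g s hs
  have h := e.measurableEmbedding.integral_map (μ := μ) f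
  rw [hmap] at h
  exact h.symm

/-- The entries of `V P V*` with `P` the projection to `span {e_a, e_b}`. -/
noncomputable def auxX (a b : Fin d) (V : Matrix (Fin d) (Fin d) ℂ) (i j : Fin d) : ℂ :=
  V i a * star (V j a) + V i b * star (V j b)

noncomputable def auxP (a b : Fin d) (V : Matrix (Fin d) (Fin d) ℂ) (i : Fin d) : ℝ :=
  Complex.normSq (V i a) + Complex.normSq (V i b)

theorem auxX_self (a b : Fin d) (V : Matrix (Fin d) (Fin d) ℂ) (i : Fin d) :
    auxX a b V i i = (auxP a b V i : ℂ) := by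
  simp [auxX, auxP, Complex.mul_conj]

theorem aux_normSq_self (a b : Fin d) (V : Matrix (Fin d) (Fin d) ℂ) (i : Fin d) :
    Complex.normSq (auxX a b V i i) = auxP a b V i * auxP a b V i := by
  rw [auxX_self, Complex.normSq_ofReal]

theorem aux_meas_P (a b i : Fin d) :
    Measurable (fun V : Matrix.unitaryGroup (Fin d) ℂ => auxP a b V i) :=
  (Complex.continuous_normSq.measurable.comp (aux_meas_entry i a)).add
    (Complex.continuous_normSq.measurable.comp (aux_meas_entry i b))

theorem aux_meas_X (a b i j : Fin d) :
    Measurable (fun V : Matrix.unitaryGroup (Fin d) ℂ => auxX a b V i j) :=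
  ((aux_meas_entry i a).mul (continuous_star.measurable.comp (aux_meas_entry j a))).add
    ((aux_meas_entry i b).mul (continuous_star.measurable.comp (aux_meas_entry j b)))

theorem aux_bound_X (a b i j : Fin d) (V : Matrix.unitaryGroup (Fin d) ℂ) :
    ‖auxX a b V i j‖ ≤ 2 := by
  have h := fun i j => entry_norm_bound_of_unitary V.2 i j
  unfold auxX
  refine (norm_add_le _ _).trans ?_
  rw [norm_mul, norm_mul, norm_star, norm_star]
  have h1 := mul_le_one₀ (h i a) (norm_nonneg _) (h j a)
  have h2 := mul_le_one₀ (h i b) (norm_nonneg _) (h j b)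
  linarith

theorem aux_bound_P (a b i : Fin d) (V : Matrix.unitaryGroup (Fin d) ℂ) :
    ‖auxP a b V i‖ ≤ 2 := by
  have h := aux_bound_X a b i i V
  rwa [auxX_self, Complex.norm_real] at h

theorem aux_int_PP (μ : Measure (Matrix.unitaryGroup (Fin d) ℂ)) [IsProbabilityMeasure μ]
    (a b i j : Fin d) :
    Integrable (fun V : Matrix.unitaryGroup (Fin d) ℂ => auxP a b V i * auxP a b V j) μ := by
  refine Integrable.of_bound ((aux_meas_P a b i).mul (aux_meas_P a b j)).aestronglyMeasurable 4
    (Filter.Eventually.of_forall fun V => ?_)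
  rw [norm_mul]
  nlinarith [aux_bound_P a b i V, aux_bound_P a b j V, norm_nonneg (auxP a b V i),
    norm_nonneg (auxP a b V j)]

theorem aux_int_P (μ : Measure (Matrix.unitaryGroup (Fin d) ℂ)) [IsProbabilityMeasure μ]
    (a b i : Fin d) :
    Integrable (fun V : Matrix.unitaryGroup (Fin d) ℂ => auxP a b V i) μ :=
  Integrable.of_bound (aux_meas_P a b i).aestronglyMeasurable 2
    (Filter.Eventually.of_forall fun V => aux_bound_P a b i V)

theorem aux_int_X (μ : Measure (Matrix.unitaryGroup (Fin d) ℂ)) [IsProbabilityMeasure μ]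
    (a b i j : Fin d) :
    Integrable (fun V : Matrix.unitaryGroup (Fin d) ℂ => Complex.normSq (auxX a b V i j)) μ := by
  refine Integrable.of_bound
    (Complex.continuous_normSq.measurable.comp (aux_meas_X a b i j)).aestronglyMeasurable 4
    (Filter.Eventually.of_forall fun V => ?_)
  rw [Real.norm_eq_abs, abs_of_nonneg (Complex.normSq_nonneg _), Complex.normSq_eq_norm_sq]
  nlinarith [aux_bound_X a b i j V, norm_nonneg (auxX a b V i j)]

theorem aux_cols (V : Matrix.unitaryGroup (Fin d) ℂ) (a b : Fin d) :
    ∑ j, star ((V : Matrix (Fin d) (Fin d) ℂ) j a) * (V : Matrix (Fin d) (Fin d) ℂ) j b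
      = if a = b then 1 else 0 := by
  have h := Matrix.mem_unitaryGroup_iff'.1 V.2
  have h2 := congrFun (congrFun h a) b
  rw [Matrix.mul_apply, Matrix.one_apply] at h2
  exact h2

theorem aux_sum_P (V : Matrix.unitaryGroup (Fin d) ℂ) (a b : Fin d) :
    ∑ i, auxP a b V i = 2 := by
  have h1 := aux_cols V a a
  have h2 := aux_cols V b b
  rw [if_pos rfl] at h1 h2
  apply Complex.ofReal_injective
  have : ∀ i, ((auxP a b V i : ℝ) : ℂ) =
      star ((V : Matrix (Fin d) (Fin d) ℂ) i a) * (V : Matrix (Fin d) (Fin d) ℂ) i a +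
      star ((V : Matrix (Fin d) (Fin d) ℂ) i b) * (V : Matrix (Fin d) (Fin d) ℂ) i b := by
    intro i
    rw [← auxX_self, auxX]
    ring
  rw [Complex.ofReal_sum, Finset.sum_congr rfl fun i _ => this i, Finset.sum_add_distrib, h1, h2]
  norm_num

theorem aux_sum_X (V : Matrix.unitaryGroup (Fin d) ℂ) (a b : Fin d) (hab : a ≠ b) (i : Fin d) :
    ∑ j, Complex.normSq (auxX a b V i j) = auxP a b V i := by
  have h1 := aux_cols V a a
  have h2 := aux_cols V b b
  have h3 := aux_cols V a b
  have h4 := aux_cols V b a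
  rw [if_pos rfl] at h1 h2
  rw [if_neg hab] at h3
  rw [if_neg hab.symm] at h4
  apply Complex.ofReal_injective
  rw [Complex.ofReal_sum, ← auxX_self]
  set W : Matrix (Fin d) (Fin d) ℂ := V.1 with hW
  have : ∀ j, ((Complex.normSq (auxX a b W i j) : ℝ) : ℂ) =
      W i a * star (W i a) * (star (W j a) * W j a) +
      W i b * star (W i b) * (star (W j b) * W j b) +
      W i a * star (W i b) * (star (W j a) * W j b) +
      W i b * star (W i a) * (star (W j b) * W j a) := by
    intro j
    rw [← Complex.mul_conj, auxX]
    simp only [map_add, map_mul, ← Complex.star_def, star_star]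
    ring
  rw [Finset.sum_congr rfl fun j _ => this j]
  simp only [Finset.sum_add_distrib, ← Finset.mul_sum]
  rw [h1, h2, h3, h4, auxX]
  ring

theorem aux_perm (σ : Equiv.Perm (Fin d)) : ∃ g : Matrix.unitaryGroup (Fin d) ℂ,
    ∀ (V : Matrix.unitaryGroup (Fin d) ℂ) (i a : Fin d),
      ((g * V : Matrix.unitaryGroup (Fin d) ℂ) : Matrix (Fin d) (Fin d) ℂ) i a =
        (V : Matrix (Fin d) (Fin d) ℂ) (σ i) a := by
  let G : Matrix (Fin d) (Fin d) ℂ := Matrix.of fun i k => if k = σ i then 1 else 0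
  have hG : G ∈ Matrix.unitaryGroup (Fin d) ℂ := by
    rw [Matrix.mem_unitaryGroup_iff]
    ext i j
    simp [G, Matrix.mul_apply, Matrix.star_apply, Matrix.one_apply, eq_comm]
  refine ⟨⟨G, hG⟩, fun V i a => ?_⟩
  change (G * (V : Matrix (Fin d) (Fin d) ℂ)) i a = _
  simp [G, Matrix.mul_apply]

theorem aux_refl (i j : Fin d) (hij : i ≠ j) (z : ℂ) (hz : z * star z = 1) :
    ∃ g : Matrix.unitaryGroup (Fin d) ℂ,
    ∀ (V : Matrix.unitaryGroup (Fin d) ℂ) (a : Fin d),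
      ((g * V : Matrix.unitaryGroup (Fin d) ℂ) : Matrix (Fin d) (Fin d) ℂ) i a =
        3 / 5 * (V : Matrix (Fin d) (Fin d) ℂ) i a
          + 4 / 5 * z * (V : Matrix (Fin d) (Fin d) ℂ) j a := by
  let v : Fin d → ℂ := fun k => (if k = i then 1 else 0) + (if k = j then -2 * star z else 0)
  let G : Matrix (Fin d) (Fin d) ℂ :=
    Matrix.of fun k l => (if k = l then 1 else 0) - 2 / 5 * (v k * star (v l))
  have hv : ∑ k, star (v k) * v k = 5 := by
    have : ∀ k, star (v k) * v k = (if k = i then 1 else 0) + (if k = j then 4 else 0) := by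
      intro k
      by_cases h1 : k = i
      · have h2 : k ≠ j := fun h => hij (h1.symm.trans h)
        simp [v, h1, hij]
      · by_cases h2 : k = j
        · simp only [v, h2, hij.symm, if_true, if_false, zero_add, star_mul, star_star, star_neg]
          have : star (2 : ℂ) = 2 := by simp
          rw [this]
          linear_combination 4 * hz
        · simp [v, h1, h2]
    rw [Finset.sum_congr rfl fun k _ => this k, Finset.sum_add_distrib]
    simp
    norm_num
  have hG : G ∈ Matrix.unitaryGroup (Fin d) ℂ := by
    rw [Matrix.mem_unitaryGroup_iff]
    ext k l
    rw [Matrix.mul_apply]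
    have e : ∀ m, G k m * (star G) m l =
        (if k = m then (if l = m then 1 else 0) else 0)
        - 2 / 5 * (if k = m then v m * star (v l) else 0)
        - 2 / 5 * (if l = m then v k * star (v m) else 0)
        + 4 / 25 * (v k * star (v l)) * (star (v m) * v m) := by
      intro m
      have e1 : (star G) m l = (if l = m then 1 else 0) - 2 / 5 * (v m * star (v l)) := by
        rw [Matrix.star_apply]
        simp only [G, Matrix.of_apply, star_sub, star_mul, star_star]
        have : star (2 / 5 : ℂ) = 2 / 5 := by simp
        rw [this]
        split_ifs <;> simp <;> ring
      rw [e1]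
      simp only [G, Matrix.of_apply]
      split_ifs with h1 h2 <;> subst_vars <;> ring
    rw [Finset.sum_congr rfl fun m _ => e m]
    simp only [Finset.sum_add_distrib, Finset.sum_sub_distrib, ← Finset.mul_sum, hv]
    simp only [Finset.sum_ite_eq, Finset.mem_univ, if_true, Matrix.one_apply]
    simp only [eq_comm (a := l) (b := k)]
    ring
  refine ⟨⟨G, hG⟩, fun V a => ?_⟩
  change (G * (V : Matrix (Fin d) (Fin d) ℂ)) i a = _
  rw [Matrix.mul_apply]
  set W : Matrix (Fin d) (Fin d) ℂ := V.1
  have e : ∀ m, G i m * W m a = (if m = i then 3 / 5 * W m a else 0)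
      + (if m = j then 4 / 5 * z * W m a else 0) := by
    intro m
    have hvi : v i = 1 := by simp [v, hij]
    simp only [G, Matrix.of_apply, hvi]
    by_cases h1 : m = i
    · subst h1
      rw [hvi]
      simp [hij]
      left
      ring
    · by_cases h2 : m = j
      · subst h2
        simp [v, h1, hij]
        left
        ring
      · simp [v, h1, h2, Ne.symm h1]
  rw [Finset.sum_congr rfl fun m _ => e m, Finset.sum_add_distrib]
  simp

theorem aux_two_trans (i₀ j₀ i j : Fin d) (h0 : i₀ ≠ j₀) (h : i ≠ j) :
    ∃ σ : Equiv.Perm (Fin d), σ i₀ = i ∧ σ j₀ = j := by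
  let τ := Equiv.swap i₀ i
  refine ⟨τ * Equiv.swap j₀ (τ j), ?_, ?_⟩
  · have h1 : i₀ ≠ τ j := by
      intro h2
      have h3 : τ i₀ = τ (τ j) := congrArg τ h2
      simp only [τ, Equiv.swap_apply_left, Equiv.swap_apply_self] at h3
      exact h h3
    rw [Equiv.Perm.mul_apply, Equiv.swap_apply_of_ne_of_ne h0 h1]
    simp [τ]
  · simp [τ]

/-- pointwise averaging identity over the phases `1, -1, I, -I`. -/
theorem aux_rot_pt (x y x' y' : ℂ) :
    ∀ f : ℂ → ℝ, (∀ z, f z = Complex.normSq (3 / 5 * x + 4 / 5 * z * y)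
      + Complex.normSq (3 / 5 * x' + 4 / 5 * z * y')) →
    f 1 * f 1 + f (-1) * f (-1) + f Complex.I * f Complex.I + f (-Complex.I) * f (-Complex.I) =
      4 * ((81 / 625) * ((Complex.normSq x + Complex.normSq x') *
              (Complex.normSq x + Complex.normSq x'))
        + (256 / 625) * ((Complex.normSq y + Complex.normSq y') *
              (Complex.normSq y + Complex.normSq y'))
        + (288 / 625) * ((Complex.normSq x + Complex.normSq x') *
              (Complex.normSq y + Complex.normSq y'))
        + (288 / 625) * Complex.normSq (x * star y + x' * star y')) := by
  intro f hf
  simp only [hf]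
  have h35 : (3 / 5 : ℂ) = ((3 / 5 : ℝ) : ℂ) := by norm_num
  have h45 : (4 / 5 : ℂ) = ((4 / 5 : ℝ) : ℂ) := by norm_num
  rw [h35, h45]
  simp only [Complex.normSq_apply, Complex.add_re, Complex.add_im, Complex.mul_re, Complex.mul_im,
    Complex.ofReal_re, Complex.ofReal_im, Complex.neg_re, Complex.neg_im, Complex.I_re,
    Complex.I_im, Complex.one_re, Complex.one_im, Complex.star_def, Complex.conj_re,
    Complex.conj_im]
  ring

theorem aux_rot (μ : Measure (Matrix.unitaryGroup (Fin d) ℂ)) (hμ : IsHaarProbability μ)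
    (a b i j : Fin d) (hij : i ≠ j) :
    4 * ∫ V, auxP a b V i * auxP a b V i ∂μ =
      4 * ((81 / 625) * ∫ V, auxP a b V i * auxP a b V i ∂μ
        + (256 / 625) * ∫ V, auxP a b V j * auxP a b V j ∂μ
        + (288 / 625) * ∫ V, auxP a b V i * auxP a b V j ∂μ
        + (288 / 625) * ∫ V, Complex.normSq (auxX a b V i j) ∂μ) := by
  have := hμ.1
  let F : ℂ → Matrix.unitaryGroup (Fin d) ℂ → ℝ := fun z V =>
    Complex.normSq (3 / 5 * (V : Matrix (Fin d) (Fin d) ℂ) i a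
        + 4 / 5 * z * (V : Matrix (Fin d) (Fin d) ℂ) j a)
      + Complex.normSq (3 / 5 * (V : Matrix (Fin d) (Fin d) ℂ) i b
        + 4 / 5 * z * (V : Matrix (Fin d) (Fin d) ℂ) j b)
  have key : ∀ z : ℂ, z * star z = 1 →
      Integrable (fun V => F z V * F z V) μ ∧
      ∫ V, F z V * F z V ∂μ = ∫ V, auxP a b V i * auxP a b V i ∂μ := by
    intro z hz
    obtain ⟨g, hg⟩ := aux_refl i j hij z hz
    have e : ∀ V : Matrix.unitaryGroup (Fin d) ℂ,
        F z V = auxP a b (g * V : Matrix.unitaryGroup (Fin d) ℂ) i := by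
      intro V
      simp only [F, auxP, hg]
    simp only [e]
    constructor
    · refine Integrable.of_bound (((aux_meas_P a b i).comp (aux_meas_mul g)).mul
        ((aux_meas_P a b i).comp (aux_meas_mul g))).aestronglyMeasurable 4
        (Filter.Eventually.of_forall fun V => ?_)
      have hb := aux_bound_P a b i (g * V)
      rw [norm_mul]
      nlinarith [norm_nonneg (auxP a b (g * V : Matrix.unitaryGroup (Fin d) ℂ) i)]
    · exact aux_inv μ hμ g (fun V => auxP a b V i * auxP a b V i)
  obtain ⟨i1, k1⟩ := key 1 (by simp)
  obtain ⟨i2, k2⟩ := key (-1) (by simp)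
  obtain ⟨i3, k3⟩ := key Complex.I (by simp)
  obtain ⟨i4, k4⟩ := key (-Complex.I) (by simp)
  have hl : ∫ V, (F 1 V * F 1 V + F (-1) V * F (-1) V + F Complex.I V * F Complex.I V
      + F (-Complex.I) V * F (-Complex.I) V) ∂μ
      = 4 * ∫ V, auxP a b V i * auxP a b V i ∂μ := by
    rw [integral_add ((i1.fun_add i2).fun_add i3) i4, integral_add (i1.fun_add i2) i3, integral_add i1 i2,
      k1, k2, k3, k4]
    ring
  rw [← hl]
  have e : ∀ V, (F 1 V * F 1 V + F (-1) V * F (-1) V + F Complex.I V * F Complex.I V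
      + F (-Complex.I) V * F (-Complex.I) V) =
      4 * ((81 / 625) * (auxP a b V i * auxP a b V i)
        + (256 / 625) * (auxP a b V j * auxP a b V j)
        + (288 / 625) * (auxP a b V i * auxP a b V j)
        + (288 / 625) * Complex.normSq (auxX a b V i j)) := by
    intro V
    exact aux_rot_pt _ _ _ _ (fun z => F z V) (fun z => rfl)
  simp only [e]
  have j1 := (aux_int_PP μ a b i i).const_mul (81 / 625)
  have j2 := (aux_int_PP μ a b j j).const_mul (256 / 625)
  have j3 := (aux_int_PP μ a b i j).const_mul (288 / 625)
  have j4 := (aux_int_X μ a b i j).const_mul (288 / 625)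
  rw [integral_const_mul, integral_add ((j1.fun_add j2).fun_add j3) j4, integral_add (j1.fun_add j2) j3,
    integral_add j1 j2]
  simp only [integral_const_mul]

theorem aux_sum_ite (i : Fin d) (A B : ℝ) :
    ∑ j : Fin d, (if i = j then A else B) = A + ((d : ℝ) - 1) * B := by
  have : ∀ j : Fin d, (if i = j then A else B) = (if i = j then A - B else 0) + B := by
    intro j
    split_ifs <;> ring
  rw [Finset.sum_congr rfl fun j _ => this j, Finset.sum_add_distrib]
  simp
  ring

theorem aux_moments (hd : 2 ≤ d) (μ : Measure (Matrix.unitaryGroup (Fin d) ℂ))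
    (hμ : IsHaarProbability μ) (a b : Fin d) (hab : a ≠ b) (i j : Fin d) :
    2 * ∫ V, Complex.normSq (auxX a b V i j) ∂μ - ∫ V, auxP a b V i * auxP a b V j ∂μ =
      if i = j then 6 / ((d : ℝ) * (d + 1)) else - 6 / ((d : ℝ) * ((d : ℝ) ^ 2 - 1)) := by
  have := hμ.1
  let A := ∫ V, auxP a b V a * auxP a b V a ∂μ
  let B := ∫ V, auxP a b V a * auxP a b V b ∂μ
  let D := ∫ V, Complex.normSq (auxX a b V a b) ∂μ
  have hAB : ∀ i j, ∫ V, auxP a b V i * auxP a b V j ∂μ = if i = j then A else B := by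
    intro i j
    split_ifs with h
    · subst h
      obtain ⟨g, hg⟩ := aux_perm (Equiv.swap a i)
      have := aux_inv μ hμ g (fun V => auxP a b V a * auxP a b V a)
      simpa [auxP, hg, A] using this
    · obtain ⟨σ, h1, h2⟩ := aux_two_trans a b i j hab h
      obtain ⟨g, hg⟩ := aux_perm σ
      have := aux_inv μ hμ g (fun V => auxP a b V a * auxP a b V b)
      simpa [auxP, hg, B, h1, h2] using this
  have hD : ∀ i j, ∫ V, Complex.normSq (auxX a b V i j) ∂μ = if i = j then A else D := by
    intro i j
    split_ifs with h
    · subst h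
      simp only [aux_normSq_self, hAB, if_true]
    · obtain ⟨σ, h1, h2⟩ := aux_two_trans a b i j hab h
      obtain ⟨g, hg⟩ := aux_perm σ
      have := aux_inv μ hμ g (fun V => Complex.normSq (auxX a b V a b))
      simpa only [auxX, hg, D, h1, h2] using this
  have hrot := aux_rot μ hμ a b a b hab
  rw [hAB, hAB, hAB, hD, if_pos rfl, if_pos rfl, if_neg hab, if_neg hab] at hrot
  -- the first moment
  have hd0 : (d : ℝ) ≠ 0 := by positivity
  have hd2 : (2 : ℝ) ≤ d := by exact_mod_cast hd
  let m := ∫ V, auxP a b V a ∂μ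
  have hm : ∀ i, ∫ V, auxP a b V i ∂μ = m := by
    intro i
    obtain ⟨g, hg⟩ := aux_perm (Equiv.swap a i)
    have := aux_inv μ hμ g (fun V => auxP a b V a)
    simpa [auxP, hg, m] using this
  have hmd : (d : ℝ) * m = 2 := by
    have h : ∫ V, ∑ i, auxP a b V i ∂μ = 2 := by simp [aux_sum_P]
    rw [integral_finsetSum _ fun i _ => aux_int_P μ a b i] at h
    simpa [hm] using h
  have hX : A + ((d : ℝ) - 1) * D = m := by
    have h : ∫ V, ∑ j, Complex.normSq (auxX a b V a j) ∂μ = m := by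
      simp only [aux_sum_X _ a b hab, m]
    rw [integral_finsetSum _ fun j _ => aux_int_X μ a b a j] at h
    rw [← aux_sum_ite a, ← h]
    simp only [hD]
  have hP : A + ((d : ℝ) - 1) * B = 2 * m := by
    have h : ∫ V, ∑ j, auxP a b V a * auxP a b V j ∂μ = 2 * m := by
      simp only [← Finset.mul_sum, aux_sum_P, integral_mul_const, hm]
      ring
    rw [integral_finsetSum _ fun j _ => aux_int_PP μ a b a j] at h
    rw [← aux_sum_ite a, ← h]
    simp only [hAB]
  have hABD : A = B + D := by linarith
  rw [hAB, hD]
  have hA : (d : ℝ) * (d + 1) * A = 6 := by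
    linear_combination (d : ℝ) * hX + d * hP + 3 * hmd + d * (d - 1) * hABD
  have hp : (d : ℝ) * (d + 1) ≠ 0 := by positivity
  have hq : (d : ℝ) * ((d : ℝ) ^ 2 - 1) ≠ 0 := by
    apply mul_ne_zero hd0
    nlinarith
  split_ifs with h
  · rw [eq_div_iff hp]
    linarith
  · rw [eq_div_iff hq]
    linear_combination ((d : ℝ) * (d + 1)) * (2 * hX - hP) - hA

theorem aux_block (hd : 2 ≤ d) (c : Fin d → ℝ) (V : Matrix (Fin d) (Fin d) ℂ) :
    (((Matrix.trace (topLeftBlock2 hd (Matrix.diagonal fun i => (c i : ℂ)) V)) ^ 2 -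
      4 * (topLeftBlock2 hd (Matrix.diagonal fun i => (c i : ℂ)) V).det) / 4).re =
    ∑ i, ∑ j, c i * c j / 4 * (2 * Complex.normSq (auxX (Fin.castLE hd 0) (Fin.castLE hd 1) V i j)
      - auxP (Fin.castLE hd 0) (Fin.castLE hd 1) V i
        * auxP (Fin.castLE hd 0) (Fin.castLE hd 1) V j) := by
  set a : Fin d := Fin.castLE hd 0
  set b : Fin d := Fin.castLE hd 1
  have hM : ∀ k l, (V.conjTranspose * (Matrix.diagonal fun i => (c i : ℂ)) * V) k l =
      ∑ i, (c i : ℂ) * (star (V i k) * V i l) := by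
    intro k l
    rw [Matrix.mul_apply]
    refine Finset.sum_congr rfl fun i _ => ?_
    rw [Matrix.mul_diagonal, Matrix.conjTranspose_apply]
    ring
  have hre : (((Matrix.trace (topLeftBlock2 hd (Matrix.diagonal fun i => (c i : ℂ)) V)) ^ 2 -
      4 * (topLeftBlock2 hd (Matrix.diagonal fun i => (c i : ℂ)) V).det) / 4) =
      ((∑ i, ∑ j, c i * c j / 4 * (2 * Complex.normSq (auxX a b V i j)
      - auxP a b V i * auxP a b V j) : ℝ) : ℂ) := by
    rw [Matrix.trace_fin_two, Matrix.det_fin_two]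
    simp only [topLeftBlock2, Matrix.of_apply, hM]
    change ((∑ i, (c i : ℂ) * (star (V i a) * V i a) + ∑ i, (c i : ℂ) * (star (V i b) * V i b)) ^ 2
      - 4 * ((∑ i, (c i : ℂ) * (star (V i a) * V i a)) * (∑ i, (c i : ℂ) * (star (V i b) * V i b))
        - (∑ i, (c i : ℂ) * (star (V i a) * V i b)) * (∑ i, (c i : ℂ) * (star (V i b) * V i a))))
        / 4 = _
    have h1 : ∀ A B C E : ℂ, ((A + B) ^ 2 - 4 * (A * B - C * E)) / 4 =
      (2 * (A * A + B * B + C * E + E * C) - (A + B) * (A + B)) / 4 := by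
      intros
      ring
    rw [h1, ← Finset.sum_add_distrib]
    simp only [Finset.sum_mul_sum]
    simp only [← Finset.sum_add_distrib, Finset.mul_sum,
      ← Finset.sum_sub_distrib, Finset.sum_div, Complex.ofReal_sum]
    refine Finset.sum_congr rfl fun i _ => Finset.sum_congr rfl fun j _ => ?_
    push_cast
    rw [← auxX_self, ← auxX_self, ← Complex.mul_conj]
    simp only [auxX, map_add, map_mul, ← Complex.star_def, star_star]
    ring
  rw [hre, Complex.ofReal_re]

end Aux

/-- Weingarten-type computation: for self-adjoint `C ∈ M_d(ℂ)` and a Haar-random unitary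
`V ∈ U(d)`, the expected squared spectral radius-gap of the compression `M_V` (with
`R(M_V)² = ((Tr M_V)² − 4 det M_V)/4`) equals
`(3/(2d(d²−1)))·(d·Tr(C²) − (Tr C)²)`. -/
theorem stmt_14 (d : ℕ) (hd : 2 ≤ d) (C : Matrix (Fin d) (Fin d) ℂ) (hC : C.IsHermitian)
    (μ : Measure (Matrix.unitaryGroup (Fin d) ℂ)) (hμ : IsHaarProbability μ) :
    ∫ V : Matrix.unitaryGroup (Fin d) ℂ,
        (((Matrix.trace (topLeftBlock2 hd C (V : Matrix (Fin d) (Fin d) ℂ))) ^ 2 -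
            4 * (topLeftBlock2 hd C (V : Matrix (Fin d) (Fin d) ℂ)).det) / 4).re ∂μ =
      3 / (2 * (d : ℝ) * ((d : ℝ) ^ 2 - 1)) *
        ((d : ℝ) * (Matrix.trace (C * C)).re - ((Matrix.trace C).re) ^ 2) := by
  have := hμ.1
  set U := hC.eigenvectorUnitary with hU
  set c := hC.eigenvalues with hc
  have hspec : C = (U : Matrix (Fin d) (Fin d) ℂ) * Matrix.diagonal (fun i => (c i : ℂ)) *
      star (U : Matrix (Fin d) (Fin d) ℂ) := by
    have h := hC.spectral_theorem
    rw [Unitary.conjStarAlgAut_apply] at h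
    exact h
  have hUU : star (U : Matrix (Fin d) (Fin d) ℂ) * (U : Matrix (Fin d) (Fin d) ℂ) = 1 :=
    Matrix.mem_unitaryGroup_iff'.1 U.2
  have hblock : ∀ V : Matrix.unitaryGroup (Fin d) ℂ,
      topLeftBlock2 hd C ((U * V : Matrix.unitaryGroup (Fin d) ℂ) : Matrix (Fin d) (Fin d) ℂ) =
      topLeftBlock2 hd (Matrix.diagonal (fun i => (c i : ℂ))) V := by
    intro V
    unfold topLeftBlock2
    have : ((U * V : Matrix.unitaryGroup (Fin d) ℂ) : Matrix (Fin d) (Fin d) ℂ).conjTranspose * C *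
        ((U * V : Matrix.unitaryGroup (Fin d) ℂ) : Matrix (Fin d) (Fin d) ℂ) =
        (V : Matrix (Fin d) (Fin d) ℂ).conjTranspose * Matrix.diagonal (fun i => (c i : ℂ)) *
          (V : Matrix (Fin d) (Fin d) ℂ) := by
      change ((U : Matrix (Fin d) (Fin d) ℂ) * (V : Matrix (Fin d) (Fin d) ℂ)).conjTranspose * C *
        ((U : Matrix (Fin d) (Fin d) ℂ) * (V : Matrix (Fin d) (Fin d) ℂ)) = _
      rw [Matrix.conjTranspose_mul, ← Matrix.star_eq_conjTranspose, ← Matrix.star_eq_conjTranspose]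
      set u : Matrix (Fin d) (Fin d) ℂ := (U : Matrix (Fin d) (Fin d) ℂ)
      set v : Matrix (Fin d) (Fin d) ℂ := (V : Matrix (Fin d) (Fin d) ℂ)
      set D : Matrix (Fin d) (Fin d) ℂ := Matrix.diagonal (fun i => (c i : ℂ))
      rw [hspec]
      calc star v * star u * (u * D * star u) * (u * v)
          = star v * (star u * u) * D * (star u * u) * v := by simp only [mul_assoc]
        _ = star v * D * v := by rw [hUU]; simp only [mul_one]
    rw [this]
  have htr : (Matrix.trace C).re = ∑ i, c i := by
    rw [hC.trace_eq_sum_eigenvalues]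
    simp [c]
  have htr2 : (Matrix.trace (C * C)).re = ∑ i, c i ^ 2 := by
    have h : Matrix.trace (C * C) = ∑ i, ((c i ^ 2 : ℝ) : ℂ) := by
      set u : Matrix (Fin d) (Fin d) ℂ := (U : Matrix (Fin d) (Fin d) ℂ)
      set D : Matrix (Fin d) (Fin d) ℂ := Matrix.diagonal (fun i => (c i : ℂ)) with hDdef
      have e : C * C = u * (D * D * star u) := by
        rw [hspec]
        calc u * D * star u * (u * D * star u) = u * D * (star u * u) * D * star u := by
              simp only [mul_assoc]
          _ = _ := by rw [hUU]; simp only [mul_one, mul_assoc]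
      rw [e, Matrix.trace_mul_comm, mul_assoc, hUU, mul_one, hDdef, Matrix.diagonal_mul_diagonal,
        Matrix.trace_diagonal]
      refine Finset.sum_congr rfl fun i _ => ?_
      push_cast
      ring
    rw [h, ← Complex.ofReal_sum, Complex.ofReal_re]
  rw [htr, htr2]
  have hinv := aux_inv μ hμ U (fun V =>
    (((Matrix.trace (topLeftBlock2 hd C (V : Matrix (Fin d) (Fin d) ℂ))) ^ 2 -
            4 * (topLeftBlock2 hd C (V : Matrix (Fin d) (Fin d) ℂ)).det) / 4).re)
  rw [← hinv]
  simp only [hblock, aux_block]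
  have hab : (Fin.castLE hd 0 : Fin d) ≠ Fin.castLE hd 1 := by
    intro h
    have := congrArg Fin.val h
    simp at this
  set a : Fin d := Fin.castLE hd 0
  set b : Fin d := Fin.castLE hd 1
  have hint : ∀ i j, Integrable (fun V : Matrix.unitaryGroup (Fin d) ℂ =>
      c i * c j / 4 * (2 * Complex.normSq (auxX a b V i j) - auxP a b V i * auxP a b V j)) μ :=
    fun i j => (((aux_int_X μ a b i j).const_mul 2).sub (aux_int_PP μ a b i j)).const_mul _
  rw [integral_finsetSum _ fun i _ => integrable_finsetSum _ fun j _ => hint i j]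
  have hterm : ∀ i j, ∫ V : Matrix.unitaryGroup (Fin d) ℂ,
      c i * c j / 4 * (2 * Complex.normSq (auxX a b V i j) - auxP a b V i * auxP a b V j) ∂μ =
      (if i = j then c i * c j / 4 *
        (6 / ((d : ℝ) * (d + 1)) + 6 / ((d : ℝ) * ((d : ℝ) ^ 2 - 1))) else 0)
        - c i * c j * (6 / ((d : ℝ) * ((d : ℝ) ^ 2 - 1)) / 4) := by
    intro i j
    rw [integral_const_mul, integral_sub ((aux_int_X μ a b i j).const_mul 2)
      (aux_int_PP μ a b i j), integral_const_mul, aux_moments hd μ hμ a b hab]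
    split_ifs <;> ring
  have hsum : ∀ i, ∫ V : Matrix.unitaryGroup (Fin d) ℂ,
      ∑ j, c i * c j / 4 * (2 * Complex.normSq (auxX a b V i j) - auxP a b V i * auxP a b V j) ∂μ =
      c i ^ 2 * ((6 / ((d : ℝ) * (d + 1)) + 6 / ((d : ℝ) * ((d : ℝ) ^ 2 - 1))) / 4)
      - c i * (∑ j, c j) * (6 / ((d : ℝ) * ((d : ℝ) ^ 2 - 1)) / 4) := by
    intro i
    rw [integral_finsetSum _ fun j _ => hint i j, Finset.sum_congr rfl fun j _ => hterm i j,
      Finset.sum_sub_distrib, Finset.sum_ite_eq, if_pos (Finset.mem_univ _), ← Finset.sum_mul,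
      ← Finset.mul_sum]
    ring
  rw [Finset.sum_congr rfl fun i _ => hsum i, Finset.sum_sub_distrib, ← Finset.sum_mul,
    ← Finset.sum_mul, ← Finset.sum_mul]
  have hd2 : (2 : ℝ) ≤ d := by exact_mod_cast hd
  have h1 : (d : ℝ) ≠ 0 := by positivity
  have h2 : (d : ℝ) + 1 ≠ 0 := by positivity
  have h3 : (d : ℝ) - 1 ≠ 0 := by linarith
  have h4 : (d : ℝ) ^ 2 - 1 = (d - 1) * (d + 1) := by ring
  rw [h4]
  field_simp
  ring
end
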